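/- Let a, b, c, e ∈ ℂ with e, c, a+c−e+1, b+c−e+1, a+b+c−e+1, c+1, c−e+2 not nonpositive integers. For n ∈ ℕ define S(n) := [Γ(a+c−e+1+n) Γ(b+c−e+1+n) / (Γ(c−e+1+n) Γ(a+b+c−e+1+n))] · ∑_{k=0}^∞ (a)_k (b)_k (c+n)_k / ((e)_k (a+b+c−e+1+n)_k · k!). Then for every n ∈ ℕ: S(n) = S(0) + [Γ(e) Γ(a+c−e+1) Γ(b+c−e+1) / (Γ(a) Γ(b) Γ(c+1) Γ(c−e+2))] · ∑_{k=0}^{n−1} (a+c−e+1)_k (b+c−e+1)_k / ((c+1)_k (c−e+2)_k). -/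

import Mathlib

open Complex

/-- Pochhammer symbol `(a)_k = a (a+1) ⋯ (a+k-1)`. -/
noncomputable def poch (a : ℂ) (k : ℕ) : ℂ := ∏ i ∈ Finset.range k, (a + i)

/-- The normalized sum `S(n)` for the nonterminating Saalschützian series. -/
noncomputable def Ssaal (a b c e : ℂ) (n : ℕ) : ℂ :=
  Complex.Gamma (a + c - e + 1 + n) * Complex.Gamma (b + c - e + 1 + n) /
      (Complex.Gamma (c - e + 1 + n) * Complex.Gamma (a + b + c - e + 1 + n)) *
    ∑' k : ℕ, poch a k * poch b k * poch (c + n) k /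
      (poch e k * poch (a + b + c - e + 1 + n) k * (Nat.factorial k : ℂ))

open Filter Topology

lemma poch_succ (s : ℂ) (k : ℕ) : poch s (k + 1) = poch s k * (s + k) :=
  Finset.prod_range_succ _ _

lemma mul_poch_add_one (s : ℂ) (k : ℕ) : s * poch (s + 1) k = poch s k * (s + k) := by
  rw [← poch_succ, poch, poch, Finset.prod_range_succ', mul_comm]
  simp [add_assoc, add_comm (1 : ℂ)]

lemma poch_ne_zero {s : ℂ} (hs : ∀ m : ℕ, s ≠ -(m : ℂ)) (k : ℕ) : poch s k ≠ 0 :=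
  Finset.prod_ne_zero_iff.mpr fun i _ h => hs i (eq_neg_of_add_eq_zero_left h)

lemma Gamma_add_nat {s : ℂ} (hs : ∀ m : ℕ, s ≠ -(m : ℂ)) (k : ℕ) :
    Gamma (s + k) = Gamma s * poch s k := by
  induction k with
  | zero => simp [poch]
  | succ k ih =>
    have h : s + k ≠ 0 := fun h => hs k (eq_neg_of_add_eq_zero_left h)
    rw [poch_succ, Nat.cast_succ, ← add_assoc, Gamma_add_one _ h, ih]
    ring

lemma GammaSeq_eq_div_poch (s : ℂ) (n : ℕ) :
    GammaSeq s n = (n : ℂ) ^ s * n.factorial / poch s (n + 1) := rfl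

lemma tendsto_inv_GammaSeq (s : ℂ) :
    Tendsto (fun n => (GammaSeq s n)⁻¹) atTop (𝓝 (Gamma s)⁻¹) := by
  by_cases hs : ∀ m : ℕ, s ≠ -(m : ℂ)
  · exact (GammaSeq_tendsto_Gamma s).inv₀ (Gamma_ne_zero hs)
  · push Not at hs
    obtain ⟨m, rfl⟩ := hs
    rw [Gamma_neg_nat_eq_zero, inv_zero]
    refine tendsto_const_nhds.congr' ?_
    filter_upwards [eventually_ge_atTop m] with n hn
    have : poch (-(m : ℂ)) (n + 1) = 0 :=
      Finset.prod_eq_zero (Finset.mem_range.mpr (Nat.lt_succ_of_le hn)) (by simp)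
    simp [GammaSeq_eq_div_poch, this]

/-- The `k`-th term of the hypergeometric series `₃F₂(a, b, c; e, d; 1)`. -/
noncomputable def hypTerm (a b c e d : ℂ) (k : ℕ) : ℂ :=
  poch a k * poch b k * poch c k / (poch e k * poch d k * (Nat.factorial k : ℂ))

lemma hypTerm_succ (a b c e d : ℂ) (k : ℕ) :
    hypTerm a b c e d (k + 1) =
      hypTerm a b c e d k * ((a + k) * (b + k) * (c + k) / ((e + k) * (d + k) * (k + 1))) := by
  simp only [hypTerm, poch_succ, Nat.factorial_succ]
  push_cast
  rw [div_mul_div_comm]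
  congr 1 <;> ring

lemma hypTerm_succ_eq_GammaSeq {a b c e d : ℂ} (h : e + d = a + b + c + 1) {k : ℕ} (hk : k ≠ 0) :
    hypTerm a b c e d (k + 1) * (k * (k + 1)) =
      GammaSeq e k * GammaSeq d k *
        ((GammaSeq a k)⁻¹ * (GammaSeq b k)⁻¹ * (GammaSeq c k)⁻¹) := by
  have hk0 : (k : ℂ) ≠ 0 := Nat.cast_ne_zero.mpr hk
  have hk1 : (k : ℂ) + 1 ≠ 0 := Nat.cast_add_one_ne_zero k
  have hf : (k.factorial : ℂ) ≠ 0 := Nat.cast_ne_zero.mpr k.factorial_ne_zero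
  have hpow : (k : ℂ) ^ e * (k : ℂ) ^ d = (k : ℂ) ^ a * (k : ℂ) ^ b * (k : ℂ) ^ c * k := by
    rw [← cpow_add _ _ hk0, h, cpow_add _ _ hk0, cpow_add _ _ hk0, cpow_add _ _ hk0, cpow_one]
  have hp (s : ℂ) : (k : ℂ) ^ s ≠ 0 := by simp [cpow_eq_zero_iff, hk0]
  have ha := hp a
  have hb := hp b
  have hc := hp c
  simp only [hypTerm, GammaSeq_eq_div_poch, Nat.factorial_succ, inv_div]
  push_cast
  calc _ = poch a (k + 1) * poch b (k + 1) * poch c (k + 1) /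
        (poch e (k + 1) * poch d (k + 1)) * (k / k.factorial) := by
        field_simp
    _ = poch a (k + 1) * poch b (k + 1) * poch c (k + 1) /
        (poch e (k + 1) * poch d (k + 1)) * (((k : ℂ) ^ e * (k : ℂ) ^ d) * k.factorial ^ 2 /
          ((k : ℂ) ^ a * (k : ℂ) ^ b * (k : ℂ) ^ c * k.factorial ^ 3)) := by
        rw [hpow]
        field_simp
    _ = _ := by
        simp only [div_eq_mul_inv, mul_inv]
        ring

lemma tendsto_hypTerm_succ_mul {a b c e d : ℂ} (h : e + d = a + b + c + 1) :
    Tendsto (fun k : ℕ => hypTerm a b c e d (k + 1) * (k * (k + 1))) atTop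
      (𝓝 (Gamma e * Gamma d * ((Gamma a)⁻¹ * (Gamma b)⁻¹ * (Gamma c)⁻¹))) := by
  refine (((GammaSeq_tendsto_Gamma e).mul (GammaSeq_tendsto_Gamma d)).mul
    (((tendsto_inv_GammaSeq a).mul (tendsto_inv_GammaSeq b)).mul
      (tendsto_inv_GammaSeq c))).congr' ?_
  filter_upwards [eventually_ne_atTop 0] with k hk
  exact (hypTerm_succ_eq_GammaSeq h hk).symm

lemma summable_hypTerm {a b c e d : ℂ} (h : e + d = a + b + c + 1) :
    Summable (hypTerm a b c e d) := by
  rw [← summable_nat_add_iff 1]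
  have hO := (tendsto_hypTerm_succ_mul h).isBigO_one ℝ
  refine summable_of_isBigO_nat (Real.summable_nat_pow_inv.mpr one_lt_two) ?_
  obtain ⟨C, hC⟩ := hO.bound
  refine Asymptotics.IsBigO.of_bound C ?_
  filter_upwards [hC, eventually_gt_atTop 0] with k hk hk0
  have hk' : (0 : ℝ) < k := Nat.cast_pos.mpr hk0
  have hn : ‖(k : ℂ) + 1‖ = (k : ℝ) + 1 := by exact_mod_cast norm_natCast (k + 1)
  rw [norm_mul, norm_mul, norm_natCast, hn, norm_one, mul_one] at hk
  rw [norm_inv, norm_pow, Real.norm_natCast, ← div_eq_mul_inv, le_div_iff₀ (by positivity)]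
  refine le_trans (mul_le_mul_of_nonneg_left ?_ (norm_nonneg _)) hk
  nlinarith

lemma hypTerm_contiguous {a b c e d : ℂ} (h : e + d = a + b + c + 1)
    (he : ∀ m : ℕ, e ≠ -(m : ℂ)) (hd : ∀ m : ℕ, d ≠ -(m : ℂ)) (hc : c ≠ 0) (k : ℕ) :
    (a + (c - e + 1)) * (b + (c - e + 1)) * hypTerm a b (c + 1) e (d + 1) k -
        (c - e + 1) * d * hypTerm a b c e d k =
      d / c * (hypTerm a b c e d (k + 1) * (↑(k + 1) * (e + ↑(k + 1) - 1))) -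
        d / c * (hypTerm a b c e d k * (k * (e + k - 1))) := by
  have hd0 : d ≠ 0 := by simpa using hd 0
  have hek : e + k ≠ 0 := fun h => he k (eq_neg_of_add_eq_zero_left h)
  have hdk : d + k ≠ 0 := fun h => hd k (eq_neg_of_add_eq_zero_left h)
  have hk1 : (k : ℂ) + 1 ≠ 0 := Nat.cast_add_one_ne_zero k
  have hshift : hypTerm a b (c + 1) e (d + 1) k =
      hypTerm a b c e d k * ((c + k) * d / (c * (d + k))) := by
    have h1 : poch (c + 1) k = poch c k * (c + k) / c := by
      rw [← mul_poch_add_one, mul_div_cancel_left₀ _ hc]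
    have h2 : poch (d + 1) k = poch d k * (d + k) / d := by
      rw [← mul_poch_add_one, mul_div_cancel_left₀ _ hd0]
    have := poch_ne_zero hd k
    have := poch_ne_zero he k
    have : (k.factorial : ℂ) ≠ 0 := Nat.cast_ne_zero.mpr k.factorial_ne_zero
    rw [hypTerm, hypTerm, h1, h2]
    field_simp
  rw [hshift, hypTerm_succ]
  generalize hypTerm a b c e d k = t
  obtain rfl : d = a + b + c + 1 - e := by linear_combination h
  have e1 : e + ((k : ℂ) + 1) - 1 = e + k := by ring
  push_cast
  rw [e1]
  field_simp
  ring

lemma tsum_hypTerm_contiguous {a b c e d : ℂ} (h : e + d = a + b + c + 1)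
    (he : ∀ m : ℕ, e ≠ -(m : ℂ)) (hd : ∀ m : ℕ, d ≠ -(m : ℂ)) (hc : c ≠ 0) :
    (a + (c - e + 1)) * (b + (c - e + 1)) * ∑' k, hypTerm a b (c + 1) e (d + 1) k -
        (c - e + 1) * d * ∑' k, hypTerm a b c e d k =
      d / c * (Gamma e * Gamma d * ((Gamma a)⁻¹ * (Gamma b)⁻¹ * (Gamma c)⁻¹)) := by
  have hs := summable_hypTerm h
  have hs' : Summable (hypTerm a b (c + 1) e (d + 1)) :=
    summable_hypTerm (by linear_combination h)
  have hsum := ((hs'.hasSum.mul_left ((a + (c - e + 1)) * (b + (c - e + 1)))).sub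
    (hs.hasSum.mul_left ((c - e + 1) * d))).tendsto_sum_nat
  refine tendsto_nhds_unique hsum ?_
  simp only [hypTerm_contiguous h he hd hc]
  simp only [Finset.sum_range_sub
    (fun k : ℕ => d / c * (hypTerm a b c e d k * (k * (e + k - 1))))]
  rw [← tendsto_add_atTop_iff_nat 1]
  have hlim : Tendsto (fun k : ℕ => e * (k : ℂ)⁻¹ + 1) atTop (𝓝 1) := by
    simpa using (tendsto_inv_atTop_nhds_zero_nat (𝕜 := ℂ)).const_mul e |>.add_const 1
  have := (((tendsto_hypTerm_succ_mul h).mul hlim).const_mul (d / c))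
  rw [mul_one] at this
  refine this.congr' ?_
  filter_upwards [eventually_ne_atTop 0] with k hk
  have hk0 : (k : ℂ) ≠ 0 := Nat.cast_ne_zero.mpr hk
  push_cast
  field_simp
  ring

lemma Ssaal_eq (a b c e : ℂ) (n : ℕ) :
    Ssaal a b c e n = Ssaal a b (c + n) e 0 := by
  simp only [Ssaal, Nat.cast_zero, add_zero]
  have h (x : ℂ) : x + c - e + 1 + n = x + (c + n) - e + 1 := by ring
  rw [h a, h b, h (a + b), show c - e + 1 + n = c + n - e + 1 by ring]

lemma Ssaal_add_one_sub {a b c e : ℂ}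
    (he : ∀ m : ℕ, e ≠ -(m : ℂ)) (hc : c ≠ 0)
    (h1 : a + c - e + 1 ≠ 0) (h2 : b + c - e + 1 ≠ 0)
    (h3 : ∀ m : ℕ, a + b + c - e + 1 ≠ -(m : ℂ)) :
    Ssaal a b (c + 1) e 0 = Ssaal a b c e 0 +
      Gamma e * Gamma (a + c - e + 1) * Gamma (b + c - e + 1) /
        (Gamma a * Gamma b * Gamma (c + 1) * Gamma (c - e + 2)) := by
  have key := tsum_hypTerm_contiguous (a := a) (b := b) (c := c) (e := e)
    (d := a + b + c - e + 1) (by ring) he h3 hc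
  have hd0 : a + b + c - e + 1 ≠ 0 := by simpa using h3 0
  have hdG : Gamma (a + b + c - e + 1) ≠ 0 := Gamma_ne_zero h3
  have hq : (Gamma (c - e + 1))⁻¹ = (c - e + 1) * (Gamma (c - e + 2))⁻¹ := by
    have := one_div_Gamma_eq_self_mul_one_div_Gamma_add_one (c - e + 1)
    rwa [add_assoc (c - e), one_add_one_eq_two] at this
  simp only [Ssaal, Nat.cast_zero, add_zero]
  change _ * ∑' k, hypTerm a b (c + 1) e _ k = _ * ∑' k, hypTerm a b c e _ k + _
  rw [show a + (c + 1) - e + 1 = a + c - e + 1 + 1 by ring,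
    show b + (c + 1) - e + 1 = b + c - e + 1 + 1 by ring,
    show a + b + (c + 1) - e + 1 = a + b + c - e + 1 + 1 by ring,
    show c + 1 - e + 1 = c - e + 2 by ring,
    Gamma_add_one _ h1, Gamma_add_one _ h2, Gamma_add_one _ hd0, Gamma_add_one _ hc]
  simp only [div_eq_mul_inv, mul_inv, hq] at key ⊢
  generalize (∑' k, hypTerm a b (c + 1) e (a + b + c - e + 1 + 1) k) = T' at *
  generalize (∑' k, hypTerm a b c e (a + b + c - e + 1) k) = T at *
  generalize hD : a + b + c - e + 1 = D at *
  have i1 : D * D⁻¹ = 1 := mul_inv_cancel₀ hd0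
  have i2 : Gamma D * (Gamma D)⁻¹ = 1 := mul_inv_cancel₀ hdG
  generalize Gamma D = G at *
  generalize hX : Gamma (a + c - e + 1) = X at *
  generalize hY : Gamma (b + c - e + 1) = Y at *
  generalize (Gamma (c - e + 2))⁻¹ = Q at *
  generalize (Gamma a)⁻¹ = A at *
  generalize (Gamma b)⁻¹ = B at *
  generalize (Gamma c)⁻¹ = C at *
  generalize Gamma e = E at *
  linear_combination X * Y * Q * D⁻¹ * G⁻¹ * key + (Q * X * Y * G⁻¹ * (c - e + 1) * T +
    X * Y * Q * E * A * B * C * c⁻¹ * G * G⁻¹) * i1 + X * Y * Q * E * A * B * C * c⁻¹ * i2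

theorem saalschutz_S_formula (a b c e : ℂ)
    (he : ∀ m : ℕ, e ≠ -(m : ℂ)) (hc : ∀ m : ℕ, c ≠ -(m : ℂ))
    (h1 : ∀ m : ℕ, a + c - e + 1 ≠ -(m : ℂ))
    (h2 : ∀ m : ℕ, b + c - e + 1 ≠ -(m : ℂ))
    (h3 : ∀ m : ℕ, a + b + c - e + 1 ≠ -(m : ℂ))
    (h4 : ∀ m : ℕ, c + 1 ≠ -(m : ℂ))
    (h5 : ∀ m : ℕ, c - e + 2 ≠ -(m : ℂ)) :
    ∀ n : ℕ,
      Ssaal a b c e n = Ssaal a b c e 0 +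
        Complex.Gamma e * Complex.Gamma (a + c - e + 1) * Complex.Gamma (b + c - e + 1) /
          (Complex.Gamma a * Complex.Gamma b * Complex.Gamma (c + 1) *
            Complex.Gamma (c - e + 2)) *
        ∑ k ∈ Finset.range n,
          poch (a + c - e + 1) k * poch (b + c - e + 1) k /
            (poch (c + 1) k * poch (c - e + 2) k) := by
  intro n
  induction n with
  | zero => simp
  | succ n ih =>
    have hn {s : ℂ} (hs : ∀ m : ℕ, s ≠ -(m : ℂ)) (m : ℕ) : s + n ≠ -(m : ℂ) := fun h =>
      hs (m + n) (by push_cast; linear_combination h)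
    have e1 (x : ℂ) : x + (c + n) - e + 1 = x + c - e + 1 + n := by ring
    have step := Ssaal_add_one_sub (a := a) (b := b) (c := c + n) (e := e) he
      (by simpa using hn hc 0) (by rw [e1]; simpa using hn h1 0)
      (by rw [e1]; simpa using hn h2 0) (by rw [e1]; exact hn h3)
    rw [Finset.sum_range_succ, mul_add, ← add_assoc, ← ih, Ssaal_eq a b c e n, Ssaal_eq,
      Nat.cast_succ, ← add_assoc, step, e1, e1, show c + n + 1 = c + 1 + n by ring,
      show c + n - e + 2 = c - e + 2 + n by ring, Gamma_add_nat h1, Gamma_add_nat h2,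
      Gamma_add_nat h4, Gamma_add_nat h5]
    simp only [div_eq_mul_inv, mul_inv]
    ring
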